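/- Let U(x) = x, U_a = E[X], U_b = E[Y] for nonnegative integrable random variables X, Y. RPS(1) preferences are not shift-invariant: there exist X, Y and a shift s > 0 such that E[U_b/(U_a+U_b+X)] < E[U_a/(U_a+U_b+Y)] but, with X' = X+s, Y' = Y+s, U_a' = U_a+s, U_b' = U_b+s, the inequality E[U_b'/(U_a'+U_b'+X')] < E[U_a'/(U_a'+U_b'+Y')] fails or the strict preference reverses. -/

import Mathlib

open MeasureTheory

/-- The law of a fair coin. -/
noncomputable def fairCoin : Measure Bool :=
  (2⁻¹ : ENNReal) • (Measure.dirac true + Measure.dirac false)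

instance : IsProbabilityMeasure fairCoin :=
  ⟨by simp [fairCoin, ENNReal.inv_two_add_inv_two]⟩

theorem integral_fairCoin (f : Bool → ℝ) :
    ∫ ω, f ω ∂fairCoin = (f true + f false) / 2 := by
  rw [fairCoin, integral_smul_measure, integral_add_measure .of_finite .of_finite,
    integral_dirac, integral_dirac]
  simp
  ring

theorem rps_not_shift_invariant :
    ∃ (Ω : Type) (_ : MeasurableSpace Ω) (μ : Measure Ω) (_ : IsProbabilityMeasure μ)
      (X Y : Ω → ℝ) (s : ℝ),
      Integrable X μ ∧ Integrable Y μ ∧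
      (∀ ω, 0 ≤ X ω) ∧ (∀ ω, 0 ≤ Y ω) ∧ 0 < s ∧
      (let Ua := ∫ ω, X ω ∂μ; let Ub := ∫ ω, Y ω ∂μ;
        (∫ ω, Ub / (Ua + Ub + X ω) ∂μ) < ∫ ω, Ua / (Ua + Ub + Y ω) ∂μ) ∧
      ¬ (let Ua := (∫ ω, X ω ∂μ) + s; let Ub := (∫ ω, Y ω ∂μ) + s;
        (∫ ω, Ub / (Ua + Ub + (X ω + s)) ∂μ) < ∫ ω, Ua / (Ua + Ub + (Y ω + s)) ∂μ) := by
  refine ⟨Bool, inferInstance, fairCoin, inferInstance, fun _ => 1,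
    fun ω => if ω then 21 / 10 else 0, 10, .of_finite, .of_finite, fun _ => zero_le_one,
    fun ω => ?_, by norm_num, ?_, ?_⟩
  · cases ω <;> norm_num
  · simp only [integral_fairCoin]
    norm_num
  · simp only [integral_fairCoin]
    norm_num
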